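/- For every n ≥ 1 there exists ε_n > 0, depending only on n, with the following property. Let K, L ⊆ ℝⁿ be convex bodies, with cent(K) = 0 and the Binet–Legendre ellipsoid of K equal to the closed Euclidean unit ball Bⁿ, i.e. ((n+2)/vol(K))∫_K φ(y)² dy = ‖φ‖² for every linear functional φ. Suppose 0 < ε ≤ ε_n and there exist an invertible affine map T : ℝⁿ → ℝⁿ and z ∈ ℝⁿ with K ⊆ T(L) ⊆ (1 + ε)·K + z. Then there exists an invertible affine map g : ℝⁿ → ℝⁿ such that the body L' = g(L) has centroid 0, Binet–Legendre ellipsoid Bⁿ, and satisfies K ⊆ L' + λ·Bⁿ and L' ⊆ K + λ·Bⁿ with λ = (3n+1)·(1 + 5n·b_n/a_n)·b_n·ε, where a_n = 2^{-n/2-1}·n^{-3n/4-3/2} and b_n = 2^{n/2+1}·n^{3n/4+3/2}. -/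

import Mathlib

open Set Metric Pointwise MeasureTheory

/-- The centroid (center of mass) of a set `K ⊆ ℝⁿ`. -/
noncomputable def centroid {n : ℕ} (K : Set (EuclideanSpace ℝ (Fin n))) :
    EuclideanSpace ℝ (Fin n) :=
  (volume K).toReal⁻¹ • ∫ x in K, x

/-- The Binet–Legendre ellipsoid of `K` is the Euclidean unit ball, expressed via the
defining inner product on linear functionals. -/
def isBLUnitBall {n : ℕ} (K : Set (EuclideanSpace ℝ (Fin n))) : Prop :=
  ∀ φ : EuclideanSpace ℝ (Fin n) →L[ℝ] ℝ,
    ((n : ℝ) + 2) / (volume K).toReal * ∫ y in K, (φ y) ^ 2 = ‖φ‖ ^ 2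

/-- `aConst n = 2^(-n/2-1) * n^(-3n/4-3/2)`. -/
noncomputable def aConst (n : ℕ) : ℝ :=
  (2 : ℝ) ^ (-(n : ℝ) / 2 - 1) * (n : ℝ) ^ (-(3 * (n : ℝ)) / 4 - 3 / 2)

/-- `bConst n = 2^(n/2+1) * n^(3n/4+3/2)`. -/
noncomputable def bConst (n : ℕ) : ℝ :=
  (2 : ℝ) ^ ((n : ℝ) / 2 + 1) * (n : ℝ) ^ (3 * (n : ℝ) / 4 + 3 / 2)

section UniformAverages

open scoped ProbabilityTheory

variable {n : ℕ}

local notation "E" n => EuclideanSpace ℝ (Fin n)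

lemma centroid_eq_integral_cond (K : Set (E n)) : centroid K = ∫ x, x ∂volume[|K] := by
  simp [centroid, ProbabilityTheory.cond, integral_smul_measure]

lemma isBLUnitBall_iff (K : Set (E n)) :
    isBLUnitBall K ↔
      ∀ v : E n, ((n : ℝ) + 2) * ∫ y, (inner ℝ v y) ^ 2 ∂volume[|K] = ‖v‖ ^ 2 := by
  have key : ∀ φ : (E n) →L[ℝ] ℝ,
      ((n : ℝ) + 2) / (volume K).toReal * ∫ y in K, (φ y) ^ 2 =
        ((n : ℝ) + 2) * ∫ y, (φ y) ^ 2 ∂volume[|K] := by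
    intro φ
    simp [ProbabilityTheory.cond, integral_smul_measure, div_eq_mul_inv, mul_assoc]
  constructor
  · intro h v
    have := h (innerSL ℝ v)
    rw [key] at this
    simpa [innerSL_apply_norm] using this
  · intro h φ
    rw [key]
    have := h ((InnerProductSpace.toDual ℝ (E n)).symm φ)
    simpa using this

lemma IsCompact.integrable_cond_volume {G : Type*} [NormedAddCommGroup G] {K : Set (E n)}
    (hK : IsCompact K) {f : (E n) → G} (hf : Continuous f) : Integrable f volume[|K] := by
  by_cases h0 : volume K = 0
  · simp [ProbabilityTheory.cond, Measure.restrict_eq_zero.2 h0]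
  · exact (hf.continuousOn.integrableOn_compact hK).smul_measure (ENNReal.inv_ne_top.2 h0)

lemma integral_cond_image_affineEquiv {G : Type*} [NormedAddCommGroup G] [NormedSpace ℝ G]
    (g : (E n) ≃ᵃ[ℝ] (E n)) {s : Set (E n)} (hs : MeasurableSet s) (f : (E n) → G) :
    ∫ x, f x ∂volume[|g '' s] = ∫ x, f (g x) ∂volume[|s] := by
  set A : (E n) →L[ℝ] (E n) := LinearMap.toContinuousLinearMap (g.linear : (E n) →ₗ[ℝ] (E n))
  have hg : ∀ x, g x = A x + g 0 := by
    intro x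
    have := g.map_vadd 0 x
    simpa [A] using this
  have hd : ∀ x ∈ s, HasFDerivWithinAt g A s x := by
    intro x _
    have : (g : (E n) → (E n)) = fun x => A x + g 0 := funext hg
    rw [this]
    exact (A.hasFDerivAt.add_const _).hasFDerivWithinAt
  have hdet : |A.det| ≠ 0 := by
    rw [abs_ne_zero]
    exact (LinearEquiv.isUnit_det' g.linear).ne_zero
  have key : ∀ {H : Type _} [NormedAddCommGroup H] [NormedSpace ℝ H] (f : (E n) → H),
      ∫ x in g '' s, f x = |A.det| • ∫ x in s, f (g x) := by
    intro H _ _ f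
    rw [integral_image_eq_integral_abs_det_fderiv_smul volume hs hd g.injective.injOn,
      integral_smul]
  have hvol : (volume (g '' s)).toReal = |A.det| * (volume s).toReal := by
    have h1 : volume (g '' s) = ENNReal.ofReal |A.det| * volume s := by
      have h2 : g '' s = (fun y => y + g 0) '' (A '' s) := by
        rw [image_image]
        exact image_congr fun x _ => hg x
      rw [h2, image_add_right, measure_preimage_add_right]
      exact Measure.addHaar_image_continuousLinearMap volume A s
    rw [h1, ENNReal.toReal_mul, ENNReal.toReal_ofReal (abs_nonneg _)]
  simp only [ProbabilityTheory.cond, integral_smul_measure, ENNReal.toReal_inv]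
  rw [key, hvol, smul_smul]
  congr 1
  field_simp

lemma volume_real_smul_add_singleton (K : Set (E n)) {r : ℝ} (hr : 0 ≤ r) (z : E n) :
    volume.real (r • K + {z}) = r ^ n * volume.real K := by
  rw [add_singleton, image_add_right, measureReal_def, measure_preimage_add_right,
    Measure.addHaar_smul, ENNReal.toReal_mul, finrank_euclideanSpace_fin,
    abs_of_nonneg (by positivity), ENNReal.toReal_ofReal (by positivity), measureReal_def]

lemma integral_cond_eq {G : Type*} [NormedAddCommGroup G] [NormedSpace ℝ G]
    (K : Set (E n)) (f : (E n) → G) :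
    ∫ x, f x ∂volume[|K] = (volume.real K)⁻¹ • ∫ x in K, f x := by
  simp [ProbabilityTheory.cond, integral_smul_measure, measureReal_def]

/-- Shrinking `K` towards a point of `K` by a factor two costs a factor `2 ^ n` in volume, which
bounds the circumradius of a convex body in terms of its second moments. -/
lemma norm_sq_le_of_isBLUnitBall {K : Set (E n)} (hK : IsCompact K) (hKc : Convex ℝ K)
    (hvol : 0 < volume.real K) (hcent : centroid K = 0) (hBL : isBLUnitBall K)
    {x : E n} (hx : x ∈ K) : ((n : ℝ) + 2) * ‖x‖ ^ 2 ≤ 4 * 2 ^ n := by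
  have hne : volume K ≠ 0 := fun h => by simp [measureReal_def, h] at hvol
  have : IsProbabilityMeasure volume[|K] :=
    ProbabilityTheory.cond_isProbabilityMeasure_of_finite hne hK.measure_lt_top.ne
  rw [centroid_eq_integral_cond] at hcent
  have hm := (isBLUnitBall_iff K).1 hBL x
  set φ : (E n) → ℝ := fun y => inner ℝ x y with hφ
  have hφc : Continuous φ := by fun_prop
  set g : (E n) ≃ᵃ[ℝ] (E n) :=
    (LinearEquiv.smulOfNeZero ℝ (E n) (1 / 2 : ℝ) (by norm_num)).toAffineEquiv.trans
      (AffineEquiv.constVAdd ℝ (E n) ((1 / 2 : ℝ) • x))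
  have hg : ∀ y, g y = (1 / 2 : ℝ) • x + (1 / 2 : ℝ) • y := by
    intro y
    change (1 / 2 : ℝ) • x +ᵥ (1 / 2 : ℝ) • y = _
    rw [vadd_eq_add]
  have himg : g '' K = (1 / 2 : ℝ) • K + {(1 / 2 : ℝ) • x} := by
    rw [add_singleton, ← image_smul, image_image]
    exact image_congr fun y _ => by rw [hg, add_comm]
  have hsub : g '' K ⊆ K := by
    rintro _ ⟨y, hy, rfl⟩
    rw [hg]
    exact hKc hx hy (by norm_num) (by norm_num) (by norm_num)
  have hv' : volume.real (g '' K) = (1 / 2) ^ n * volume.real K := by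
    rw [himg, volume_real_smul_add_singleton _ (by norm_num)]
  have hmono : ∫ y in g '' K, φ y ^ 2 ≤ ∫ y in K, φ y ^ 2 :=
    setIntegral_mono_set ((hφc.pow 2).continuousOn.integrableOn_compact hK)
      (Filter.Eventually.of_forall fun y => sq_nonneg _) hsub.eventuallyLE
  have h1 := integral_cond_eq K (fun y => φ y ^ 2)
  have h2 := integral_cond_eq (g '' K) (fun y => φ y ^ 2)
  rw [integral_cond_image_affineEquiv g hK.measurableSet] at h2
  have hmean : ∫ y, φ y ∂volume[|K] = 0 := by
    have := integral_inner (𝕜 := ℝ) (hK.integrable_cond_volume continuous_id) x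
    simpa [hcent] using this
  have hexp : ∫ y, φ (g y) ^ 2 ∂volume[|K] =
      1 / 4 * (‖x‖ ^ 2) ^ 2 + 1 / 4 * ∫ y, φ y ^ 2 ∂volume[|K] := by
    have : ∀ y, φ (g y) ^ 2 =
        1 / 4 * (‖x‖ ^ 2) ^ 2 + (1 / 2 * ‖x‖ ^ 2) * φ y + 1 / 4 * φ y ^ 2 := by
      intro y
      simp only [hφ, hg, inner_add_right, inner_smul_right, real_inner_self_eq_norm_sq]
      ring
    simp_rw [this]
    rw [integral_add (hK.integrable_cond_volume (by fun_prop))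
      (hK.integrable_cond_volume (by fun_prop)), integral_add (integrable_const _)
      (hK.integrable_cond_volume (by fun_prop)), integral_const_mul (1 / 2 * ‖x‖ ^ 2), hmean,
      integral_const]
    simp only [probReal_univ, one_smul, mul_zero, add_zero, integral_const_mul]
  rw [hexp, hv'] at h2
  set m := ∫ y, φ y ^ 2 ∂volume[|K]
  have hm0 : (n + 2 : ℝ) * m = ‖x‖ ^ 2 := hm
  have hle : 1 / 4 * (‖x‖ ^ 2) ^ 2 + 1 / 4 * m ≤ 2 ^ n * m := by
    rw [h2]
    have : (1 / 2 : ℝ) ^ n = (2 ^ n)⁻¹ := by simp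
    rw [this, h1, smul_eq_mul, smul_eq_mul, mul_inv, inv_inv, ← mul_assoc]
    gcongr
  have hmn : 0 ≤ m := integral_nonneg fun y => sq_nonneg _
  rcases eq_or_ne x 0 with rfl | hx0
  · simp
  have hp : 0 < ‖x‖ ^ 2 := by positivity
  have hn2 : (0 : ℝ) < n + 2 := by positivity
  have : ((n : ℝ) + 2) * (‖x‖ ^ 2) * ‖x‖ ^ 2 ≤ 4 * 2 ^ n * ‖x‖ ^ 2 := by
    have := mul_le_mul_of_nonneg_left hle hn2.le
    have h3 : ((n : ℝ) + 2) * (1 / 4 * (‖x‖ ^ 2) ^ 2 + 1 / 4 * m) =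
        1 / 4 * (((n : ℝ) + 2) * (‖x‖ ^ 2) * ‖x‖ ^ 2) + 1 / 4 * ‖x‖ ^ 2 := by
      linear_combination 1 / 4 * hm0
    have h4 : ((n : ℝ) + 2) * (2 ^ n * m) = 2 ^ n * ‖x‖ ^ 2 := by
      linear_combination 2 ^ n * hm0
    rw [h3, h4] at this
    linarith
  exact le_of_mul_le_mul_right this hp

/-- Uniform averages over nested sets of comparable volume are close. -/
lemma norm_integral_cond_sub_le {G : Type*} [NormedAddCommGroup G] [NormedSpace ℝ G]
    {K M : Set (E n)} (hK : IsCompact K) (hM : IsCompact M) (hKM : K ⊆ M)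
    (hvol : 0 < volume.real K) {η : ℝ} (hη : volume.real M ≤ (1 + η) * volume.real K)
    {f : (E n) → G} (hf : Continuous f) {F : ℝ} (hF : ∀ x ∈ M, ‖f x‖ ≤ F) :
    ‖∫ x, f x ∂volume[|M] - ∫ x, f x ∂volume[|K]‖ ≤ 2 * η * F := by
  have hne : K.Nonempty := by
    rw [nonempty_iff_ne_empty]
    rintro rfl
    simp at hvol
  obtain ⟨x₀, hx₀⟩ := hne
  have hF0 : 0 ≤ F := (norm_nonneg _).trans (hF x₀ (hKM hx₀))
  have hfi := hf.continuousOn.integrableOn_compact (μ := volume) hM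
  have hsplit := setIntegral_sdiff hK.measurableSet hfi hKM
  have hvd : volume.real (M \ K) = volume.real M - volume.real K :=
    measureReal_sdiff hKM hK.measurableSet hM.measure_lt_top.ne
  have hD : ‖∫ x in M \ K, f x‖ ≤ F * (volume.real M - volume.real K) := by
    rw [← hvd]
    exact norm_setIntegral_le_of_norm_le_const
      ((measure_mono sdiff_subset).trans_lt hM.measure_lt_top) fun x hx => hF x hx.1
  have hI : ‖∫ x in K, f x‖ ≤ F * volume.real K :=
    norm_setIntegral_le_of_norm_le_const hK.measure_lt_top fun x hx => hF x (hKM hx)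
  have hmv : volume.real K ≤ volume.real M := measureReal_mono hKM hM.measure_lt_top.ne
  set v := volume.real K
  set m := volume.real M
  have hm : 0 < m := hvol.trans_le hmv
  have heq : ∫ x, f x ∂volume[|M] - ∫ x, f x ∂volume[|K] =
      m⁻¹ • (∫ x in M \ K, f x) - ((m - v) / (m * v)) • ∫ x in K, f x := by
    rw [integral_cond_eq, integral_cond_eq, hsplit, smul_sub, sub_sub, ← add_smul]
    congr 2
    change v⁻¹ = m⁻¹ + _
    field_simp
    ring
  rw [heq]
  refine (norm_sub_le _ _).trans ?_
  rw [norm_smul, norm_smul, Real.norm_of_nonneg (by positivity),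
    Real.norm_of_nonneg (div_nonneg (by linarith) (by positivity))]
  have h1 : m⁻¹ * ‖∫ x in M \ K, f x‖ ≤ F * ((m - v) / m) := by
    calc _ ≤ m⁻¹ * (F * (m - v)) := by gcongr
      _ = _ := by ring
  have h2 : (m - v) / (m * v) * ‖∫ x in K, f x‖ ≤ F * ((m - v) / m) := by
    calc _ ≤ (m - v) / (m * v) * (F * v) :=
          mul_le_mul_of_nonneg_left hI (div_nonneg (by linarith) (by positivity))
      _ = _ := by field_simp
  have h3 : (m - v) / m ≤ η := by
    rw [div_le_iff₀ hm]
    have : 0 ≤ η := by nlinarith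
    nlinarith
  nlinarith

end UniformAverages

lemma abs_inv_sqrt_sub_one_le {s δ : ℝ} (hδ : δ ≤ 1 / 2) (hs : |s - 1| ≤ δ) :
    |(√s)⁻¹ - 1| ≤ δ := by
  have hs' := abs_le.1 hs
  have hs0 : 1 / 2 ≤ s := by linarith
  have hr : 1 / 2 ≤ √s := Real.le_sqrt_of_sq_le (by linarith)
  have hsq : √s ^ 2 = s := Real.sq_sqrt (by linarith)
  have h : (√s)⁻¹ - 1 = (1 - s) / (√s * (1 + √s)) := by
    have : √s ≠ 0 := by positivity
    field_simp
    nlinarith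
  rw [h, abs_div, abs_of_pos (by positivity : 0 < √s * (1 + √s)), abs_sub_comm]
  refine (div_le_self (abs_nonneg _) ?_).trans hs
  nlinarith

/-- A symmetric operator whose quadratic form is `δ`-close to `‖·‖ ^ 2` has an inverse square root
that is `δ`-close to the identity. -/
lemma LinearMap.IsSymmetric.exists_linearEquiv_inner_eq_norm_sq {V : Type*}
    [NormedAddCommGroup V] [InnerProductSpace ℝ V] [FiniteDimensional ℝ V] {S : V →ₗ[ℝ] V}
    (hS : S.IsSymmetric) {δ : ℝ} (hδ : δ ≤ 1 / 2)
    (h : ∀ v, ‖v‖ = 1 → |inner ℝ (S v) v - 1| ≤ δ) :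
    ∃ A : V ≃ₗ[ℝ] V, (∀ x y, inner ℝ (A x) y = inner ℝ x (A y)) ∧
      (∀ y, inner ℝ (S (A y)) (A y) = ‖y‖ ^ 2) ∧ ∀ x, ‖A x - x‖ ≤ δ * ‖x‖ := by
  set e := hS.eigenvectorBasis rfl
  set s := hS.eigenvalues rfl
  have hs : ∀ i, |s i - 1| ≤ δ := by
    intro i
    have := h (e i) (e.norm_eq_one i)
    rw [hS.apply_eigenvectorBasis rfl i] at this
    change |inner ℝ (s i • e i) (e i) - 1| ≤ δ at this
    simpa [inner_smul_left] using this
  have hs0 : ∀ i, 0 < s i := fun i => by linarith [(abs_le.1 (hs i)).1]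
  have hne : ∀ i, (√(s i))⁻¹ ≠ 0 := fun i => inv_ne_zero (Real.sqrt_pos.2 (hs0 i)).ne'
  let A₀ : V →ₗ[ℝ] V := ∑ i, (√(s i))⁻¹ • (innerₛₗ ℝ (e i)).smulRight (e i)
  have hA₀ : ∀ x i, inner ℝ (e i) (A₀ x) = (√(s i))⁻¹ * inner ℝ (e i) x := by
    intro x i
    simp [A₀, inner_sum, inner_smul_right, e.inner_eq_ite]
  have hinj : Function.Injective A₀ := by
    rw [injective_iff_map_eq_zero]
    intro x hx
    refine InnerProductSpace.ext_inner_left_basis e.toBasis fun i => ?_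
    have := hA₀ x i
    rw [hx, inner_zero_right] at this
    simpa using (mul_eq_zero.1 this.symm).resolve_left (hne i)
  refine ⟨LinearEquiv.ofInjectiveEndo A₀ hinj, ?_, ?_, ?_⟩
  · intro x y
    simp only [LinearEquiv.coe_ofInjectiveEndo]
    rw [← e.sum_inner_mul_inner, ← e.sum_inner_mul_inner]
    refine Finset.sum_congr rfl fun i _ => ?_
    rw [real_inner_comm, hA₀, hA₀, real_inner_comm (e i) x]
    ring
  · intro y
    simp only [LinearEquiv.coe_ofInjectiveEndo]
    rw [← e.sum_inner_mul_inner, ← e.sum_sq_norm_inner_right]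
    refine Finset.sum_congr rfl fun i _ => ?_
    rw [hS, hS.apply_eigenvectorBasis rfl i, inner_smul_right, real_inner_comm, hA₀]
    have h2 : √(s i) ^ 2 = s i := Real.sq_sqrt (hs0 i).le
    have h3 : √(s i) ≠ 0 := (Real.sqrt_pos.2 (hs0 i)).ne'
    change s i * _ * _ = _
    rw [Real.norm_eq_abs, sq_abs]
    nth_rewrite 1 [← h2]
    field_simp
  · intro x
    have hδ0 : 0 ≤ δ ∨ x = 0 := by
      rcases isEmpty_or_nonempty (Fin (Module.finrank ℝ V)) with hE | ⟨⟨i⟩⟩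
      · right
        exact InnerProductSpace.ext_inner_left_basis e.toBasis fun i => hE.elim i
      · left
        exact (abs_nonneg _).trans (hs i)
    rcases hδ0 with hδ0 | rfl
    swap
    · simp
    refine le_of_sq_le_sq ?_ (by positivity)
    rw [mul_pow, ← e.sum_sq_norm_inner_right, ← e.sum_sq_norm_inner_right x, Finset.mul_sum]
    refine Finset.sum_le_sum fun i _ => ?_
    simp only [LinearEquiv.coe_ofInjectiveEndo]
    rw [inner_sub_right, hA₀, ← sub_one_mul, norm_mul, mul_pow, Real.norm_eq_abs]
    gcongr
    exact abs_inv_sqrt_sub_one_le hδ (hs i)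

section Normalization

open scoped ProbabilityTheory

variable {n : ℕ}

local notation "E" n => EuclideanSpace ℝ (Fin n)

lemma exists_isSymmetric_inner_eq_integral_cond {M : Set (E n)} (hM : IsCompact M) (c : E n) :
    ∃ S : (E n) →ₗ[ℝ] (E n), S.IsSymmetric ∧
      ∀ v, inner ℝ (S v) v = ((n : ℝ) + 2) * ∫ w, (inner ℝ v (w - c)) ^ 2 ∂volume[|M] := by
  have hint : ∀ v : E n, Integrable (fun w => inner ℝ v (w - c) • (w - c)) volume[|M] :=
    fun v => hM.integrable_cond_volume (by fun_prop)
  let S : (E n) →ₗ[ℝ] (E n) :=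
    { toFun := fun v => ((n : ℝ) + 2) • ∫ w, inner ℝ v (w - c) • (w - c) ∂volume[|M]
      map_add' := fun u v => by
        simp only [inner_add_left, add_smul (inner ℝ u _)]
        rw [integral_add (hint u) (hint v), smul_add]
      map_smul' := fun r v => by
        simp only [inner_smul_left, mul_smul]
        rw [integral_smul, smul_comm]
        rfl }
  have hS : ∀ u v, inner ℝ u (S v) =
      ((n : ℝ) + 2) * ∫ w, inner ℝ v (w - c) * inner ℝ u (w - c) ∂volume[|M] := by
    intro u v
    change inner ℝ u (((n : ℝ) + 2) • ∫ w, inner ℝ v (w - c) • (w - c) ∂volume[|M]) = _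
    rw [inner_smul_right, ← integral_inner (hint v)]
    simp only [inner_smul_right]
  refine ⟨S, fun u v => ?_, fun v => ?_⟩
  · rw [hS, real_inner_comm, hS]
    simp only [mul_comm]
  · rw [real_inner_comm, hS]
    simp only [pow_two]

/-- If a set of radius `R` is covered by its dilate by `1 + ε` shifted by `z`, then the shift is at
most `ε * R`: test the inclusion at a minimiser of `⟪z, ·⟫`. -/
lemma norm_le_of_subset_smul_add_singleton {V : Type*} [NormedAddCommGroup V]
    [InnerProductSpace ℝ V] {K : Set V} (hK : IsCompact K) (hne : K.Nonempty) {R ε : ℝ}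
    (hR : ∀ x ∈ K, ‖x‖ ≤ R) (hε : 0 ≤ ε) {z : V} (h : K ⊆ (1 + ε) • K + {z}) :
    ‖z‖ ≤ ε * R := by
  obtain ⟨x, hx, hmin⟩ := hK.exists_isMinOn hne
    (f := fun x => inner ℝ z x) (by fun_prop)
  have hx' := h hx
  rw [add_singleton] at hx'
  obtain ⟨_, ⟨k, hk, rfl⟩, hkx⟩ := hx'
  have h1 : inner ℝ z x = (1 + ε) * inner ℝ z k + ‖z‖ ^ 2 := by
    rw [← hkx]
    simp only [inner_add_right, inner_smul_right, real_inner_self_eq_norm_sq]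
  have h2 : inner ℝ z x ≤ inner ℝ z k := hmin hk
  have h3 : -(‖z‖ * ‖k‖) ≤ inner ℝ z k := (abs_le.1 (abs_real_inner_le_norm z k)).1
  have h4 := hR k hk
  have h5 : ‖z‖ * ‖z‖ ≤ ‖z‖ * (ε * R) := by
    have : ε * (‖z‖ * ‖k‖) ≤ ε * (‖z‖ * R) := by gcongr
    nlinarith
  rcases (norm_nonneg z).eq_or_lt' with h0 | h0
  · rw [h0]
    obtain ⟨y, hy⟩ := hne
    exact mul_nonneg hε ((norm_nonneg y).trans (hR y hy))
  · exact le_of_mul_le_mul_left h5 h0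

lemma exists_affineEquiv_isBLUnitBall_image (hn : 1 ≤ n) {K M : Set (E n)} (hK : IsCompact K)
    (hM : IsCompact M) (hvol : 0 < volume.real K) (hcent : centroid K = 0)
    (hBL : isBLUnitBall K) {R ε : ℝ} (hR1 : 1 ≤ R) (hε : 0 < ε)
    (hε' : ε ≤ 1 / (1000 * n * (n + 2) * R ^ 2)) (hKM : K ⊆ M)
    (hMR : ∀ x ∈ M, ‖x‖ ≤ (1 + 2 * ε) * R)
    (hMvol : volume.real M ≤ (1 + 2 * n * ε) * volume.real K) :
    ∃ g : (E n) ≃ᵃ[ℝ] (E n), centroid (g '' M) = 0 ∧ isBLUnitBall (g '' M) ∧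
      ∀ x ∈ M, ‖g x - x‖ ≤ (4.01 * n + 4.2 * n * (n + 2) * R ^ 2) * R * ε := by
  have hneK : volume K ≠ 0 := fun h => by simp [measureReal_def, h] at hvol
  have hneM : volume M ≠ 0 := fun h => hneK (measure_mono_null hKM h)
  have : IsProbabilityMeasure volume[|K] :=
    ProbabilityTheory.cond_isProbabilityMeasure_of_finite hneK hK.measure_lt_top.ne
  have : IsProbabilityMeasure volume[|M] :=
    ProbabilityTheory.cond_isProbabilityMeasure_of_finite hneM hM.measure_lt_top.ne
  have hn1 : (1 : ℝ) ≤ n := by exact_mod_cast hn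
  have hεb : ε * (1000 * n * (n + 2) * R ^ 2) ≤ 1 := by
    rwa [le_div_iff₀ (by positivity)] at hε'
  have hR2 : 1 ≤ R ^ 2 := one_le_pow₀ hR1
  have hnR : n * ε * (n + 2) ≤ 1 / 1000 := by
    have : n * ε * (n + 2) * 1 ≤ n * ε * (n + 2) * R ^ 2 := by gcongr
    linarith
  have hnε : n * ε ≤ 1 / 3000 := by
    have : n * ε * 3 ≤ n * ε * (n + 2) := by gcongr; linarith
    linarith
  have hε3 : ε ≤ 1 / 3000 := by
    have : 1 * ε ≤ n * ε := by gcongr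
    linarith
  have hR' : (1 + 2 * ε) * R ≤ 1.001 * R := by gcongr; linarith
  have hR0 : 0 < R := by linarith
  set c : E n := ∫ x, x ∂volume[|M] with hc
  have hcb : ‖c‖ ≤ 4.01 * n * ε * R := by
    have h := norm_integral_cond_sub_le (η := 2 * n * ε) hK hM hKM hvol hMvol
      (continuous_id) (fun x hx => (hMR x hx).trans hR')
    simp only [id] at h
    rw [← centroid_eq_integral_cond K, hcent, sub_zero] at h
    refine h.trans ?_
    have : 0 ≤ n * ε * R := by positivity
    linarith
  have hcb' : ‖c‖ ≤ 0.01 * R := by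
    refine hcb.trans ?_
    have : n * ε * R ≤ 1 / 3000 * R := by gcongr
    linarith
  obtain ⟨S, hS, hSq⟩ := exists_isSymmetric_inner_eq_integral_cond hM c
  set δ : ℝ := 4.1 * n * (n + 2) * ε * R ^ 2 with hδdef
  have hδ : δ ≤ 1 / 2 := by
    rw [hδdef]; linarith
  have hclose : ∀ v, ‖v‖ = 1 → |inner ℝ (S v) v - 1| ≤ δ := by
    intro v hv
    have hexp : ∫ w, (inner ℝ v (w - c)) ^ 2 ∂volume[|M] =
        ∫ w, (inner ℝ v w) ^ 2 ∂volume[|M] - (inner ℝ v c) ^ 2 := by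
      have hmean : ∫ w, inner ℝ v w ∂volume[|M] = inner ℝ v c := by
        have := integral_inner (𝕜 := ℝ) (hM.integrable_cond_volume continuous_id) v
        simpa using this
      have : ∀ w : E n, (inner ℝ v (w - c)) ^ 2 =
          (inner ℝ v w) ^ 2 - (2 * inner ℝ v c) * inner ℝ v w + (inner ℝ v c) ^ 2 := by
        intro w
        rw [inner_sub_right]
        ring
      simp_rw [this]
      rw [integral_add (hM.integrable_cond_volume (by fun_prop)) (integrable_const _),
        integral_sub (hM.integrable_cond_volume (by fun_prop))
        (hM.integrable_cond_volume (by fun_prop)), integral_const_mul, hmean, integral_const]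
      simp only [probReal_univ, one_smul]
      ring
    have h1 := (isBLUnitBall_iff K).1 hBL v
    rw [hv, one_pow] at h1
    have h2 := norm_integral_cond_sub_le (η := 2 * n * ε) hK hM hKM hvol hMvol
      (f := fun w => (inner ℝ v w) ^ 2) (by fun_prop) (F := (1.001 * R) ^ 2) (fun x hx => by
        have : |inner ℝ v x| ≤ 1.001 * R := by
          refine (abs_real_inner_le_norm v x).trans ?_
          rw [hv, one_mul]
          exact (hMR x hx).trans hR'
        rw [norm_pow, Real.norm_eq_abs]
        gcongr)
    have h3 : (inner ℝ v c) ^ 2 ≤ 0.0401 * n * ε * R ^ 2 := by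
      have h4 : |inner ℝ v c| ≤ ‖c‖ := by
        simpa [hv] using abs_real_inner_le_norm v c
      calc (inner ℝ v c) ^ 2 = |inner ℝ v c| * |inner ℝ v c| := by rw [← pow_two, sq_abs]
        _ ≤ ‖c‖ * ‖c‖ := by gcongr
        _ ≤ (0.01 * R) * (4.01 * n * ε * R) := by gcongr
        _ = 0.0401 * n * ε * R ^ 2 := by ring
    rw [hSq, hexp]
    set IM := ∫ w, (inner ℝ v w) ^ 2 ∂volume[|M]
    set IK := ∫ w, (inner ℝ v w) ^ 2 ∂volume[|K]
    have h5 : ((n : ℝ) + 2) * (IM - inner ℝ v c ^ 2) - 1 =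
        ((n : ℝ) + 2) * ((IM - IK) - inner ℝ v c ^ 2) := by
      linear_combination h1
    rw [h5, abs_mul, abs_of_pos (by positivity : (0 : ℝ) < n + 2)]
    have h6 : |(IM - IK) - inner ℝ v c ^ 2| ≤ 4.1 * n * ε * R ^ 2 := by
      refine (abs_sub _ _).trans ?_
      rw [abs_of_nonneg (sq_nonneg (inner ℝ v c))]
      rw [Real.norm_eq_abs] at h2
      have : 0 ≤ n * ε * R ^ 2 := by positivity
      nlinarith
    calc _ ≤ ((n : ℝ) + 2) * (4.1 * n * ε * R ^ 2) := by gcongr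
      _ = δ := by rw [hδdef]; ring
  obtain ⟨A, hAsymm, hAS, hAid⟩ := hS.exists_linearEquiv_inner_eq_norm_sq hδ hclose
  set g : (E n) ≃ᵃ[ℝ] (E n) :=
    (AffineEquiv.constVAdd ℝ (E n) (-c)).trans A.toAffineEquiv
  have hg : ∀ x, g x = A (x - c) := by
    intro x
    change A (-c +ᵥ x) = _
    rw [vadd_eq_add, neg_add_eq_sub]
  refine ⟨g, ?_, ?_, ?_⟩
  · rw [centroid_eq_integral_cond, integral_cond_image_affineEquiv g hM.measurableSet]
    simp_rw [hg]
    have h1 := (LinearMap.toContinuousLinearMap (A : (E n) →ₗ[ℝ] (E n))).integral_comp_comm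
      (hM.integrable_cond_volume (f := fun x => x - c) (by fun_prop))
    rw [integral_sub (f := fun x => x) (hM.integrable_cond_volume continuous_id)
      (integrable_const _), integral_const] at h1
    simpa [← hc] using h1
  · rw [isBLUnitBall_iff]
    intro v
    rw [integral_cond_image_affineEquiv g hM.measurableSet]
    simp_rw [hg, ← hAsymm]
    rw [← hSq, hAS]
  · intro x hx
    rw [hg]
    have h1 : A (x - c) - x = (A (x - c) - (x - c)) - c := by abel
    rw [h1]
    have h2 : ‖x - c‖ ≤ 1.02 * R :=
      (norm_sub_le _ _).trans (by linarith [(hMR x hx).trans hR'])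
    have hδ0 : 0 ≤ δ := by positivity
    calc _ ≤ ‖A (x - c) - (x - c)‖ + ‖c‖ := norm_sub_le _ _
      _ ≤ δ * (1.02 * R) + 4.01 * n * ε * R := by
        gcongr
        exact (hAid _).trans (by gcongr)
      _ ≤ _ := by
        have : 0 ≤ n * (n + 2) * ε * R ^ 2 * R := by positivity
        rw [hδdef]
        linarith

end Normalization

lemma one_add_pow_le_one_add_two_mul (n : ℕ) {ε : ℝ} (hε : 0 ≤ ε) (h : n * ε ≤ 1) :
    (1 + ε) ^ n ≤ 1 + 2 * n * ε := by
  have h0 : 0 ≤ n * ε := by positivity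
  calc (1 + ε) ^ n ≤ Real.exp ε ^ n := by
        gcongr
        linarith [Real.add_one_le_exp ε]
    _ = Real.exp (n * ε) := by rw [← Real.exp_nat_mul]
    _ ≤ 1 + 2 * n * ε := by
        have h1 := Real.abs_exp_sub_one_sub_id_le (x := n * ε) (by rwa [abs_of_nonneg h0])
        have h2 := (abs_le.1 h1).2
        nlinarith

lemma aConst_mul_bConst {n : ℕ} (hn : 1 ≤ n) : aConst n * bConst n = 1 := by
  have hn0 : (0 : ℝ) < n := by exact_mod_cast hn
  rw [aConst, bConst, mul_mul_mul_comm, ← Real.rpow_add two_pos, ← Real.rpow_add hn0]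
  ring_nf
  simp

lemma two_rpow_le_bConst {n : ℕ} (hn : 1 ≤ n) : (2 : ℝ) ^ ((n : ℝ) / 2 + 1) ≤ bConst n := by
  have hn1 : (1 : ℝ) ≤ n := by exact_mod_cast hn
  exact le_mul_of_one_le_right (by positivity) (Real.one_le_rpow hn1 (by positivity))

lemma one_le_bConst {n : ℕ} (hn : 1 ≤ n) : 1 ≤ bConst n :=
  (Real.one_le_rpow one_le_two (by positivity)).trans (two_rpow_le_bConst hn)

lemma norm_le_bConst {n : ℕ} (hn : 1 ≤ n) {r : ℝ}
    (h : ((n : ℝ) + 2) * r ^ 2 ≤ 4 * 2 ^ n) : r ≤ bConst n := by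
  refine le_trans ?_ (two_rpow_le_bConst hn)
  refine le_of_sq_le_sq ?_ (by positivity)
  have h1 : ((2 : ℝ) ^ ((n : ℝ) / 2 + 1)) ^ 2 = 4 * 2 ^ n := by
    rw [← Real.rpow_natCast, ← Real.rpow_mul two_pos.le]
    have : ((n : ℝ) / 2 + 1) * (2 : ℕ) = (n : ℝ) + 2 := by push_cast; ring
    rw [this, Real.rpow_add two_pos, Real.rpow_natCast]
    norm_num
    ring
  rw [h1]
  have : 0 ≤ (n : ℝ) * r ^ 2 := by positivity
  nlinarith [sq_nonneg r]

theorem stmt7 :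
    ∀ n : ℕ, 1 ≤ n → ∃ εn : ℝ, 0 < εn ∧
      ∀ K L : Set (EuclideanSpace ℝ (Fin n)),
        IsCompact K → Convex ℝ K → (interior K).Nonempty →
        IsCompact L → Convex ℝ L → (interior L).Nonempty →
        centroid K = 0 → isBLUnitBall K →
        ∀ ε : ℝ, 0 < ε → ε ≤ εn →
          (∃ (T : EuclideanSpace ℝ (Fin n) ≃ᵃ[ℝ] EuclideanSpace ℝ (Fin n))
              (z : EuclideanSpace ℝ (Fin n)),
              K ⊆ T '' L ∧ T '' L ⊆ (1 + ε) • K + {z}) →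
          ∃ g : EuclideanSpace ℝ (Fin n) ≃ᵃ[ℝ] EuclideanSpace ℝ (Fin n),
            centroid (g '' L) = 0 ∧ isBLUnitBall (g '' L) ∧
            K ⊆ g '' L + ((3 * (n : ℝ) + 1) * (1 + 5 * n * bConst n / aConst n) * bConst n * ε) •
                closedBall (0 : EuclideanSpace ℝ (Fin n)) 1 ∧
            g '' L ⊆ K + ((3 * (n : ℝ) + 1) * (1 + 5 * n * bConst n / aConst n) * bConst n * ε) •
                closedBall (0 : EuclideanSpace ℝ (Fin n)) 1 := by
  intro n hn
  set b := bConst n with hb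
  have hb1 : 1 ≤ b := one_le_bConst hn
  have hn1 : (1 : ℝ) ≤ n := by exact_mod_cast hn
  refine ⟨1 / (1000 * n * (n + 2) * b ^ 2), by positivity, ?_⟩
  rintro K L hK hKc hKi hL - - hcent hBL ε hε hεn ⟨T, z, hKT, hTK⟩
  have hvol : 0 < volume.real K := by
    refine ENNReal.toReal_pos ?_ hK.measure_lt_top.ne
    exact (Measure.measure_pos_of_nonempty_interior volume hKi).ne'
  have hR : ∀ x ∈ K, ‖x‖ ≤ b := fun x hx =>
    norm_le_bConst hn (norm_sq_le_of_isBLUnitBall hK hKc hvol hcent hBL hx)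
  have hz : ‖z‖ ≤ ε * b := norm_le_of_subset_smul_add_singleton hK (hKi.mono interior_subset)
    hR hε.le (hKT.trans hTK)
  have hnear : ∀ x ∈ T '' L, ∃ k ∈ K, ‖x - k‖ ≤ 2 * b * ε := by
    intro x hx
    have hx' := hTK hx
    rw [add_singleton] at hx'
    obtain ⟨_, ⟨k, hk, rfl⟩, rfl⟩ := hx'
    refine ⟨k, hk, ?_⟩
    have h1 : (1 + ε) • k + z - k = ε • k + z := by rw [add_smul, one_smul]; abel
    change ‖(1 + ε) • k + z - k‖ ≤ _
    rw [h1]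
    refine (norm_add_le _ _).trans ?_
    rw [norm_smul, Real.norm_of_nonneg hε.le]
    have := mul_le_mul_of_nonneg_left (hR k hk) hε.le
    linarith
  have hTLR : ∀ x ∈ T '' L, ‖x‖ ≤ (1 + 2 * ε) * b := by
    intro x hx
    obtain ⟨k, hk, hxk⟩ := hnear x hx
    have := norm_le_norm_add_norm_sub k x
    linarith [hR k hk, norm_sub_rev x k]
  have hTL : IsCompact (T '' L) :=
    hL.image T.toContinuousAffineEquiv.continuous
  have hnε : n * ε ≤ 1 := by
    rw [le_div_iff₀ (by positivity)] at hεn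
    have : n * ε * 1 ≤ n * ε * (1000 * (n + 2) * b ^ 2) := by
      gcongr
      have : 1 ≤ b ^ 2 := one_le_pow₀ hb1
      nlinarith
    linarith
  have hTLvol : volume.real (T '' L) ≤ (1 + 2 * n * ε) * volume.real K := by
    have hcomp : IsCompact ((1 + ε) • K + {z}) := (hK.smul _).add isCompact_singleton
    refine (measureReal_mono hTK hcomp.measure_lt_top.ne).trans ?_
    rw [volume_real_smul_add_singleton K (by positivity) z]
    gcongr
    exact one_add_pow_le_one_add_two_mul n hε.le hnε
  obtain ⟨g, hg0, hgBL, hgd⟩ := exists_affineEquiv_isBLUnitBall_image hn hK hTL hvol hcent hBL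
    hb1 hε hεn hKT hTLR hTLvol
  have himg : (T.trans g) '' L = g '' (T '' L) := by
    rw [image_image]
    rfl
  have ha : b / aConst n = b ^ 2 := by
    have hab := aConst_mul_bConst hn
    have : aConst n ≠ 0 := left_ne_zero_of_mul_eq_one hab
    rw [div_eq_iff this]
    linear_combination -b * hab
  have hcoef : (4.01 * n + 4.2 * n * (n + 2) * b ^ 2) * b * ε + 2 * b * ε ≤
      (3 * (n : ℝ) + 1) * (1 + 5 * n * b / aConst n) * b * ε := by
    rw [mul_div_assoc, ha, ← add_mul, ← add_mul]
    gcongr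
    have h1 : 1 ≤ b ^ 2 := one_le_pow₀ hb1
    have h2 : n ≤ n * b ^ 2 := le_mul_of_one_le_right (by positivity) h1
    have h3 : n * b ^ 2 ≤ n * (n * b ^ 2) := le_mul_of_one_le_left (by positivity) hn1
    nlinarith
  refine ⟨T.trans g, ?_⟩
  rw [himg]
  set lam := (3 * (n : ℝ) + 1) * (1 + 5 * n * b / aConst n) * b * ε
  have hpos : 0 ≤ (4.01 * n + 4.2 * n * (n + 2) * b ^ 2) * b * ε := by positivity
  have hpos' : 0 ≤ 2 * b * ε := by positivity
  rw [smul_unitClosedBall_of_nonneg (by linarith)]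
  refine ⟨hg0, hgBL, fun x hx => ?_, ?_⟩
  · refine mem_add.2 ⟨g x, mem_image_of_mem g (hKT hx), x - g x, ?_, by abel⟩
    rw [mem_closedBall_zero_iff, norm_sub_rev]
    linarith [hgd x (hKT hx)]
  · rintro _ ⟨x, hx, rfl⟩
    obtain ⟨k, hk, hxk⟩ := hnear x hx
    refine mem_add.2 ⟨k, hk, g x - k, ?_, by abel⟩
    rw [mem_closedBall_zero_iff]
    linarith [hgd x hx, norm_sub_le_norm_sub_add_norm_sub (g x) x k]
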